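/- arXiv:2005.09595 — 3 statements merged into one kernel-verified Lean document; each statement's English description precedes it below -/
import Mathlib

section
/- For every δ ∈ (0,1) and every z ∈ ℝ, Σ_{k∈ℤ} exp(−π(z+k)²/δ²) < 4. -/
lemma exp_gaussian_le_geometric {δ x : ℝ} (hδ : δ ∈ Set.Ioo (0 : ℝ) 1) {n : ℕ}
    (h : (n : ℝ) ^ 2 ≤ x ^ 2) :
    Real.exp (-Real.pi * x ^ 2 / δ ^ 2) ≤ (2 / 5 : ℝ) ^ n := by
  obtain ⟨h0, h1⟩ := hδ
  have hn : (n : ℝ) ≤ (n : ℝ) ^ 2 := by exact_mod_cast Nat.le_self_pow two_ne_zero n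
  have hδ2 : δ ^ 2 ≤ 1 := pow_le_one₀ h0.le h1.le
  have hx : x ^ 2 ≤ Real.pi * x ^ 2 / δ ^ 2 := by
    rw [le_div_iff₀ (by positivity)]
    nlinarith [Real.pi_gt_three, sq_nonneg x]
  have hexp : Real.exp (-1) ≤ 2 / 5 := by
    linarith [Real.exp_neg_one_lt_d9]
  calc Real.exp (-Real.pi * x ^ 2 / δ ^ 2) ≤ Real.exp (n * (-1)) := by
        apply Real.exp_le_exp.mpr
        rw [neg_mul, neg_div]
        linarith
    _ = Real.exp (-1) ^ n := Real.exp_nat_mul _ _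
    _ ≤ (2 / 5 : ℝ) ^ n := pow_le_pow_left₀ (Real.exp_pos _).le hexp n

lemma tsum_gaussian_translates_lt_four_of_mem_Icc {δ w : ℝ} (hδ : δ ∈ Set.Ioo (0 : ℝ) 1)
    (hw : w ∈ Set.Icc (0 : ℝ) 1) :
    (∑' k : ℤ, Real.exp (-Real.pi * (w + (k : ℝ)) ^ 2 / δ ^ 2)) < 4 := by
  obtain ⟨hw0, hw1⟩ := hw
  have hgeom : HasSum (fun n : ℕ => (2 / 5 : ℝ) ^ n) (1 - 2 / 5)⁻¹ :=
    hasSum_geometric_of_lt_one (by norm_num) (by norm_num)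
  have hpos : ∀ n : ℕ,
      Real.exp (-Real.pi * (w + ((n : ℤ) : ℝ)) ^ 2 / δ ^ 2) ≤ (2 / 5 : ℝ) ^ n := fun n =>
    exp_gaussian_le_geometric hδ (by
      push_cast
      nlinarith [(Nat.cast_nonneg n : (0 : ℝ) ≤ n)])
  have hneg : ∀ n : ℕ,
      Real.exp (-Real.pi * (w + ((-((n : ℤ) + 1) : ℤ) : ℝ)) ^ 2 / δ ^ 2) ≤ (2 / 5 : ℝ) ^ n :=
    fun n => exp_gaussian_le_geometric hδ (by
      push_cast
      nlinarith [(Nat.cast_nonneg n : (0 : ℝ) ≤ n)])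
  have hspos := Summable.of_nonneg_of_le (fun n => (Real.exp_pos _).le) hpos hgeom.summable
  have hsneg := Summable.of_nonneg_of_le (fun n => (Real.exp_pos _).le) hneg hgeom.summable
  rw [tsum_of_nat_of_neg_add_one
    (f := fun k : ℤ => Real.exp (-Real.pi * (w + (k : ℝ)) ^ 2 / δ ^ 2)) hspos hsneg]
  have h1 := hspos.tsum_le_tsum hpos hgeom.summable
  have h2 := hsneg.tsum_le_tsum hneg hgeom.summable
  rw [hgeom.tsum_eq] at h1 h2
  norm_num at h1 h2 ⊢
  linarith

/-- For every `δ ∈ (0,1)` and every `z ∈ ℝ`,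
`∑_{k∈ℤ} exp(−π(z+k)²/δ²) < 4`. -/
theorem sum_gaussian_translates_lt_four (δ : ℝ) (hδ : δ ∈ Set.Ioo (0 : ℝ) 1) (z : ℝ) :
    (∑' k : ℤ, Real.exp (-Real.pi * (z + (k : ℝ)) ^ 2 / δ ^ 2)) < 4 := by
  rw [← (Equiv.subRight ⌊z⌋).tsum_eq]
  convert tsum_gaussian_translates_lt_four_of_mem_Icc hδ
    ⟨Int.fract_nonneg z, (Int.fract_lt_one z).le⟩ using 6 with k
  rw [Equiv.subRight_apply, Int.fract]
  push_cast
  ring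
end

section
/- For every γ > 0, the second moment of the one-dimensional discrete Gaussian X ~ D_{(1/γ)ℤ,1} satisfies the Poisson-summation identity E[X²] = (Σ_{k∈ℤ} (1/(2π) − γ²k²)·exp(−πγ²k²)) / (Σ_{k∈ℤ} exp(−πγ²k²)); equivalently, 1/(2π) − E[X²] = (Σ_{k∈ℤ} γ²k²·exp(−πγ²k²)) / (Σ_{k∈ℤ} exp(−πγ²k²)). -/
theorem summable_int_pow_mul_exp_neg_mul_sq (m : ℕ) {a : ℝ} (ha : 0 < a) :
    Summable fun k : ℤ ↦ (k : ℝ) ^ m * Real.exp (-Real.pi * a * (k : ℝ) ^ 2) := by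
  refine Summable.of_norm_bounded (summable_pow_mul_jacobiTheta₂_term_bound 0 ha m) fun k ↦ ?_
  rw [norm_mul, norm_pow, Real.norm_eq_abs, Real.norm_eq_abs, Real.abs_exp, Int.cast_abs]
  refine le_of_eq ?_
  congr 2
  ring

theorem hasDerivAt_tsum_exp_neg_mul_int_sq {a : ℝ} (ha : 0 < a) :
    HasDerivAt (fun t : ℝ ↦ ∑' k : ℤ, Real.exp (-Real.pi * t * (k : ℝ) ^ 2))
      (-Real.pi * ∑' k : ℤ, (k : ℝ) ^ 2 * Real.exp (-Real.pi * a * (k : ℝ) ^ 2)) a := by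
  have hmem : a ∈ Set.Ioi (a / 2) := half_lt_self ha
  have hbound := (summable_int_pow_mul_exp_neg_mul_sq 2 (half_pos ha)).mul_left Real.pi
  rw [← tsum_mul_left]
  refine hasDerivAt_tsum_of_isPreconnected hbound isOpen_Ioi isPreconnected_Ioi
    (g := fun (k : ℤ) (t : ℝ) ↦ Real.exp (-Real.pi * t * (k : ℝ) ^ 2))
    (g' := fun (k : ℤ) (t : ℝ) ↦ -Real.pi * ((k : ℝ) ^ 2 * Real.exp (-Real.pi * t * (k : ℝ) ^ 2)))
    (fun k t _ ↦ ?_) (fun k t ht ↦ ?_) hmem ?_ hmem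
  · refine ((((hasDerivAt_id' t).const_mul (-Real.pi)).mul_const ((k : ℝ) ^ 2)).exp).congr_deriv ?_
    ring
  · have ht' : a / 2 ≤ t := le_of_lt ht
    rw [norm_mul, norm_neg, Real.norm_of_nonneg Real.pi_pos.le,
      Real.norm_of_nonneg (by positivity)]
    refine mul_le_mul_of_nonneg_left (mul_le_mul_of_nonneg_left (Real.exp_le_exp.2 ?_)
      (sq_nonneg _)) Real.pi_pos.le
    rw [neg_mul, neg_mul, neg_mul, neg_mul, neg_le_neg_iff]
    gcongr
  · simpa using summable_int_pow_mul_exp_neg_mul_sq 0 ha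

/-- The derivative at `γ ^ 2` of the functional equation of the theta series. -/
theorem tsum_sq_mul_exp_neg_mul_int_sq {γ : ℝ} (hγ : 0 < γ) :
    ∑' k : ℤ, (k : ℝ) ^ 2 * Real.exp (-Real.pi * (γ ^ 2)⁻¹ * (k : ℝ) ^ 2) =
      γ ^ 3 / (2 * Real.pi) * ∑' k : ℤ, Real.exp (-Real.pi * γ ^ 2 * (k : ℝ) ^ 2) -
        γ ^ 5 * ∑' k : ℤ, (k : ℝ) ^ 2 * Real.exp (-Real.pi * γ ^ 2 * (k : ℝ) ^ 2) := by
  have ha : 0 < γ ^ 2 := by positivity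
  set T : ℝ → ℝ := fun t ↦ ∑' k : ℤ, Real.exp (-Real.pi * t * (k : ℝ) ^ 2) with hT
  have hfun : ∀ t : ℝ, 0 < t → T t⁻¹ = √t * T t := fun t ht ↦ by
    have h := Real.tsum_exp_neg_mul_int_sq ht
    rw [← Real.sqrt_eq_rpow] at h
    simp only [hT, h, ← div_eq_mul_inv]
    have := Real.sqrt_pos.2 ht
    field_simp
  have hd := hasDerivAt_tsum_exp_neg_mul_int_sq ha
  have hleft := (hasDerivAt_tsum_exp_neg_mul_int_sq (inv_pos.2 ha)).comp (γ ^ 2)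
    (hasDerivAt_inv ha.ne')
  have hright := (Real.hasDerivAt_sqrt ha.ne').mul hd
  have heq : (T ∘ fun t ↦ t⁻¹) =ᶠ[nhds (γ ^ 2)] (fun t ↦ √t * T t) := by
    filter_upwards [lt_mem_nhds ha] with t ht using hfun t ht
  have h := hleft.unique (hright.congr_of_eventuallyEq heq)
  rw [Real.sqrt_sq hγ.le] at h
  have hpi := Real.pi_pos
  field_simp at h ⊢
  linarith


/-- Poisson-summation identity for the second moment of the
one-dimensional discrete Gaussian `X ~ D_{(1/γ)ℤ,1}` (mass at `k/γ` proportional to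
`exp(−π(k/γ)²)`):
`E[X²] = (∑_{k∈ℤ} (1/(2π) − γ²k²)·exp(−πγ²k²)) / (∑_{k∈ℤ} exp(−πγ²k²))`;
equivalently,
`1/(2π) − E[X²] = (∑_{k∈ℤ} γ²k²·exp(−πγ²k²)) / (∑_{k∈ℤ} exp(−πγ²k²))`. -/
theorem discreteGaussian_secondMoment_poisson (γ : ℝ) (hγ : 0 < γ)
    (EX2 : ℝ)
    (hEX2 : EX2 = (∑' k : ℤ, ((k : ℝ) / γ) ^ 2 * Real.exp (-Real.pi * ((k : ℝ) / γ) ^ 2)) /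
        (∑' k : ℤ, Real.exp (-Real.pi * ((k : ℝ) / γ) ^ 2))) :
    EX2 = (∑' k : ℤ, (1 / (2 * Real.pi) - γ ^ 2 * (k : ℝ) ^ 2) *
            Real.exp (-Real.pi * γ ^ 2 * (k : ℝ) ^ 2)) /
          (∑' k : ℤ, Real.exp (-Real.pi * γ ^ 2 * (k : ℝ) ^ 2)) ∧
      1 / (2 * Real.pi) - EX2 =
        (∑' k : ℤ, γ ^ 2 * (k : ℝ) ^ 2 * Real.exp (-Real.pi * γ ^ 2 * (k : ℝ) ^ 2)) /
          (∑' k : ℤ, Real.exp (-Real.pi * γ ^ 2 * (k : ℝ) ^ 2)) := by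
  have ha : 0 < γ ^ 2 := by positivity
  have hsum0 : Summable fun k : ℤ ↦ Real.exp (-Real.pi * γ ^ 2 * (k : ℝ) ^ 2) := by
    simpa using summable_int_pow_mul_exp_neg_mul_sq 0 ha
  have hsum2 := summable_int_pow_mul_exp_neg_mul_sq 2 ha
  have hTpos : 0 < ∑' k : ℤ, Real.exp (-Real.pi * γ ^ 2 * (k : ℝ) ^ 2) :=
    hsum0.tsum_pos (fun _ ↦ (Real.exp_pos _).le) 0 (Real.exp_pos _)
  have hfun : ∑' k : ℤ, Real.exp (-Real.pi * ((k : ℝ) / γ) ^ 2) =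
      γ * ∑' k : ℤ, Real.exp (-Real.pi * γ ^ 2 * (k : ℝ) ^ 2) := by
    have h := Real.tsum_exp_neg_mul_int_sq ha
    rw [← Real.sqrt_eq_rpow, Real.sqrt_sq hγ.le] at h
    rw [h, ← mul_assoc, mul_one_div_cancel hγ.ne', one_mul]
    refine tsum_congr fun k ↦ congrArg Real.exp ?_
    ring
  have hnum : ∑' k : ℤ, ((k : ℝ) / γ) ^ 2 * Real.exp (-Real.pi * ((k : ℝ) / γ) ^ 2) =
      (γ ^ 2)⁻¹ * ∑' k : ℤ, (k : ℝ) ^ 2 * Real.exp (-Real.pi * (γ ^ 2)⁻¹ * (k : ℝ) ^ 2) := by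
    rw [← tsum_mul_left]
    refine tsum_congr fun k ↦ ?_
    rw [show -Real.pi * ((k : ℝ) / γ) ^ 2 = -Real.pi * (γ ^ 2)⁻¹ * (k : ℝ) ^ 2 by ring]
    ring
  have hmoment : ∑' k : ℤ, γ ^ 2 * (k : ℝ) ^ 2 * Real.exp (-Real.pi * γ ^ 2 * (k : ℝ) ^ 2) =
      γ ^ 2 * ∑' k : ℤ, (k : ℝ) ^ 2 * Real.exp (-Real.pi * γ ^ 2 * (k : ℝ) ^ 2) := by
    simp only [mul_assoc, tsum_mul_left]
  have hsplit : ∑' k : ℤ, (1 / (2 * Real.pi) - γ ^ 2 * (k : ℝ) ^ 2) *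
        Real.exp (-Real.pi * γ ^ 2 * (k : ℝ) ^ 2) =
      1 / (2 * Real.pi) * ∑' k : ℤ, Real.exp (-Real.pi * γ ^ 2 * (k : ℝ) ^ 2) -
        γ ^ 2 * ∑' k : ℤ, (k : ℝ) ^ 2 * Real.exp (-Real.pi * γ ^ 2 * (k : ℝ) ^ 2) := by
    rw [← tsum_mul_left, ← tsum_mul_left,
      ← (hsum0.mul_left _).tsum_sub (hsum2.mul_left _)]
    exact tsum_congr fun k ↦ by ring
  have hpi := Real.pi_pos
  rw [hfun, hnum, tsum_sq_mul_exp_neg_mul_int_sq hγ] at hEX2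
  rw [hsplit, hmoment, hEX2]
  generalize ∑' k : ℤ, Real.exp (-Real.pi * γ ^ 2 * (k : ℝ) ^ 2) = A at *
  generalize ∑' k : ℤ, (k : ℝ) ^ 2 * Real.exp (-Real.pi * γ ^ 2 * (k : ℝ) ^ 2) = B at *
  constructor
  · field_simp
  · field_simp
    ring
end

section
/- Let σ > 0, p > 0, and ζ ∈ (0, 1/e], and set a = √(ln(1/ζ)). Let X be a one-dimensional Gaussian with density ρ_σ(x)/σ = exp(−πx²/σ²)/σ. Then the statistical distance between the distribution of X mod p and the uniform distribution on [0,p) is at least 1 − ζ − 2aσ/p. -/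
open MeasureTheory

lemma im_I_mul_div_pi_pos {c : ℝ} (hc : 0 < c) : 0 < (Complex.I * ((c : ℂ) / Real.pi)).im := by
  rw [← Complex.ofReal_div, Complex.I_mul_im, Complex.ofReal_re]
  positivity

lemma hasSum_exp_neg_mul_add_int_sq {c : ℝ} (hc : 0 < c) (y : ℝ) :
    HasSum (fun k : ℤ ↦ Real.exp (-c * (y + k) ^ 2))
      (Real.exp (-c * y ^ 2) *
        (jacobiTheta₂ (Complex.I * (c * y / Real.pi)) (Complex.I * (c / Real.pi))).re) := by
  have hτ := im_I_mul_div_pi_pos hc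
  have h := (Complex.hasSum_re
    (hasSum_jacobiTheta₂_term (Complex.I * (c * y / Real.pi)) hτ)).mul_left
      (Real.exp (-c * y ^ 2))
  refine (congrArg (HasSum · _) (funext fun k ↦ ?_)).mpr h
  have hterm : jacobiTheta₂_term k (Complex.I * (c * y / Real.pi)) (Complex.I * (c / Real.pi)) =
      (Real.exp (-c * (2 * y * k + k ^ 2)) : ℝ) := by
    have hπ : (Real.pi : ℂ) ≠ 0 := Complex.ofReal_ne_zero.2 Real.pi_ne_zero
    rw [jacobiTheta₂_term, Complex.ofReal_exp]
    congr 1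
    push_cast
    field_simp
    linear_combination (2 * c * y * k + c * k ^ 2 : ℂ) * Complex.I_sq
  rw [hterm, Complex.ofReal_re, ← Real.exp_add]
  congr 1
  ring

lemma continuous_tsum_exp_neg_mul_add_int_sq {c : ℝ} (hc : 0 < c) :
    Continuous fun y : ℝ ↦ ∑' k : ℤ, Real.exp (-c * (y + k) ^ 2) := by
  have hτ := im_I_mul_div_pi_pos hc
  simp_rw [fun y ↦ (hasSum_exp_neg_mul_add_int_sq hc y).tsum_eq]
  have hθ : Continuous fun z : ℂ ↦ jacobiTheta₂ z (Complex.I * (c / Real.pi)) :=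
    continuous_iff_continuousAt.2 fun z ↦ (differentiableAt_jacobiTheta₂_fst z hτ).continuousAt
  have h : Continuous fun y : ℝ ↦
      (jacobiTheta₂ (Complex.I * (c * y / Real.pi)) (Complex.I * (c / Real.pi))).re :=
    Complex.continuous_re.comp (hθ.comp (by fun_prop))
  fun_prop

lemma periodic_tsum_exp_neg_mul_add_int_sq (c : ℝ) :
    Function.Periodic (fun y : ℝ ↦ ∑' k : ℤ, Real.exp (-c * (y + k) ^ 2)) 1 := by
  intro y
  refine Eq.trans ?_ ((Equiv.addRight (1 : ℤ)).tsum_eq fun k : ℤ ↦ Real.exp (-c * (y + k) ^ 2))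
  refine tsum_congr fun k ↦ ?_
  simp only [Equiv.coe_addRight, Int.cast_add, Int.cast_one]
  ring_nf

lemma integral_tsum_exp_neg_mul_add_int_sq {c : ℝ} (hc : 0 < c) :
    ∫ y in (0 : ℝ)..1, ∑' k : ℤ, Real.exp (-c * (y + k) ^ 2) = √(Real.pi / c) := by
  have hi := integrable_exp_neg_mul_sq hc
  have hs := hi.hasSum_intervalIntegral_comp_add_int
  rw [integral_gaussian] at hs
  simp only [intervalIntegral.integral_of_le zero_le_one] at hs ⊢
  refine (hasSum_integral_of_summable_integral_norm (fun k : ℤ ↦ ?_) ?_).unique hs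
  · exact (hi.comp_add_right (k : ℝ)).integrableOn
  · simpa only [Real.norm_eq_abs, Real.abs_exp] using hs.summable

lemma integral_Ioi_exp_neg_mul_sq_le {c b : ℝ} (hc : 0 < c) (hb : 0 ≤ b) :
    ∫ x in Set.Ioi b, Real.exp (-c * x ^ 2) ≤ Real.exp (-c * b ^ 2) * (√(Real.pi / c) / 2) := by
  have hi := integrable_exp_neg_mul_sq hc
  have hshift : ∫ x in Set.Ioi (0 : ℝ), Real.exp (-c * (x + b) ^ 2) =
      ∫ x in Set.Ioi b, Real.exp (-c * x ^ 2) := by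
    have h := (measurePreserving_add_right (volume : Measure ℝ) b).setIntegral_preimage_emb
      (measurableEmbedding_addRight b) (fun x ↦ Real.exp (-c * x ^ 2)) (Set.Ioi b)
    simpa using h
  rw [← hshift, ← integral_gaussian_Ioi, ← integral_const_mul]
  refine setIntegral_mono_on (hi.comp_add_right b).integrableOn
    (hi.const_mul _).integrableOn measurableSet_Ioi fun x hx ↦ ?_
  rw [← Real.exp_add]
  refine Real.exp_le_exp.2 ?_
  have := mul_nonneg hc.le (mul_nonneg (Set.mem_Ioi.1 hx).le hb)
  nlinarith

lemma le_integral_exp_neg_mul_sq {c b : ℝ} (hc : 0 < c) (hb : 0 ≤ b) :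
    √(Real.pi / c) * (1 - Real.exp (-c * b ^ 2)) ≤ ∫ x in (-b)..b, Real.exp (-c * x ^ 2) := by
  have hi := integrable_exp_neg_mul_sq hc
  have hsplit := intervalIntegral.integral_interval_add_Ioi
    (hi.integrableOn (s := Set.Ioi 0)) (hi.integrableOn (s := Set.Ioi b))
  rw [integral_gaussian_Ioi] at hsplit
  have hneg : ∫ x in (-b)..0, Real.exp (-c * x ^ 2) = ∫ x in 0..b, Real.exp (-c * x ^ 2) := by
    have h := intervalIntegral.integral_comp_neg (a := 0) (b := b)
      fun x ↦ Real.exp (-c * x ^ 2)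
    rw [neg_zero] at h
    rw [← h]
    exact intervalIntegral.integral_congr fun x _ ↦ by
      rw [neg_sq]
  rw [← intervalIntegral.integral_add_adjacent_intervals (b := 0) hi.intervalIntegrable
    hi.intervalIntegrable, hneg]
  linarith [integral_Ioi_exp_neg_mul_sq_le hc hb]

/-- The total variation distance between a periodic density and the uniform one is at least the
difference of the masses they give to a symmetric interval. -/
lemma integral_sub_le_half_integral_abs_sub_one {F : ℝ → ℝ} (hF : Continuous F)
    (hper : Function.Periodic F 1) (hone : ∫ x in (0 : ℝ)..1, F x = 1) {b : ℝ} (hb : 0 ≤ b)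
    (hb' : 2 * b ≤ 1) :
    (∫ x in (-b)..b, F x) - 2 * b ≤ (1 / 2) * ∫ x in (0 : ℝ)..1, |F x - 1| := by
  have hFi (s t : ℝ) : IntervalIntegrable F volume s t := hF.intervalIntegrable s t
  have hGc : Continuous fun x ↦ |F x - 1| := by fun_prop
  have hGi (s t : ℝ) : IntervalIntegrable (fun x ↦ |F x - 1|) volume s t :=
    hGc.intervalIntegrable s t
  have hGper : Function.Periodic (fun x ↦ |F x - 1|) 1 := fun x ↦ by simp only [hper x]
  have hF1 := hper.intervalIntegral_add_eq 0 (-b)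
  have hG1 := hGper.intervalIntegral_add_eq 0 (-b)
  rw [zero_add] at hF1 hG1
  rw [hG1, ← intervalIntegral.integral_add_adjacent_intervals (hGi (-b) b) (hGi b (-b + 1))]
  rw [hone, ← intervalIntegral.integral_add_adjacent_intervals (hFi (-b) b) (hFi b (-b + 1))] at hF1
  have hinner : (∫ x in (-b)..b, F x) - 2 * b ≤ ∫ x in (-b)..b, |F x - 1| := by
    calc (∫ x in (-b)..b, F x) - 2 * b = ∫ x in (-b)..b, (F x - 1) := by
          rw [intervalIntegral.integral_sub (hFi _ _) intervalIntegrable_const,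
            intervalIntegral.integral_const, smul_eq_mul]
          ring
      _ ≤ _ := intervalIntegral.integral_mono (by linarith)
          ((hFi _ _).sub intervalIntegrable_const) (hGi _ _) fun x ↦ le_abs_self _
  have houter : (1 - 2 * b) - ∫ x in b..(-b + 1), F x ≤ ∫ x in b..(-b + 1), |F x - 1| := by
    calc (1 - 2 * b) - ∫ x in b..(-b + 1), F x = ∫ x in b..(-b + 1), (1 - F x) := by
          rw [intervalIntegral.integral_sub intervalIntegrable_const (hFi _ _),
            intervalIntegral.integral_const, smul_eq_mul]
          ring
      _ ≤ _ := intervalIntegral.integral_mono (by linarith)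
          (intervalIntegrable_const.sub (hFi _ _)) (hGi _ _) fun x ↦ by
            simpa using neg_le_abs (F x - 1)
  linarith

/-- The Gaussian bound for period one, with `w` the ratio of the period to the width. -/
lemma one_sub_exp_sub_le_half_integral_abs_tsum_sub_one {w b : ℝ} (hw : 0 < w) (hb : 0 ≤ b)
    (hb' : 2 * b ≤ 1) :
    1 - Real.exp (-(Real.pi * w ^ 2) * b ^ 2) - 2 * b ≤ (1 / 2) * ∫ y in (0 : ℝ)..1,
      |w * (∑' k : ℤ, Real.exp (-(Real.pi * w ^ 2) * (y + k) ^ 2)) - 1| := by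
  have hc : 0 < Real.pi * w ^ 2 := by positivity
  have hcont := continuous_tsum_exp_neg_mul_add_int_sq hc
  have hsqrt : w * √(Real.pi / (Real.pi * w ^ 2)) = 1 := by
    rw [div_mul_cancel_left₀ Real.pi_ne_zero, Real.sqrt_inv, Real.sqrt_sq hw.le,
      mul_inv_cancel₀ hw.ne']
  refine le_trans ?_ (integral_sub_le_half_integral_abs_sub_one (hcont.const_mul w)
    (fun y ↦ congrArg (w * ·) (periodic_tsum_exp_neg_mul_add_int_sq _ y)) ?_ hb hb')
  · refine sub_le_sub_right ?_ _
    calc 1 - Real.exp (-(Real.pi * w ^ 2) * b ^ 2)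
        = w * (√(Real.pi / (Real.pi * w ^ 2)) *
            (1 - Real.exp (-(Real.pi * w ^ 2) * b ^ 2))) := by rw [← mul_assoc, hsqrt, one_mul]
      _ ≤ w * ∫ x in (-b)..b, Real.exp (-(Real.pi * w ^ 2) * x ^ 2) :=
          mul_le_mul_of_nonneg_left (le_integral_exp_neg_mul_sq hc hb) hw.le
      _ = ∫ x in (-b)..b, w * Real.exp (-(Real.pi * w ^ 2) * x ^ 2) :=
          (intervalIntegral.integral_const_mul _ _).symm
      _ ≤ _ := by
          refine intervalIntegral.integral_mono (by linarith)
            (Continuous.intervalIntegrable (by fun_prop) _ _)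
            ((hcont.const_mul w).intervalIntegrable _ _) fun x ↦ ?_
          refine mul_le_mul_of_nonneg_left ?_ hw.le
          have := (hasSum_exp_neg_mul_add_int_sq hc x).summable.le_tsum 0
            fun _ _ ↦ (Real.exp_pos _).le
          simpa using this
  · rw [intervalIntegral.integral_const_mul, integral_tsum_exp_neg_mul_add_int_sq hc, hsqrt]

/-- Let `σ > 0`, `p > 0`, `ζ ∈ (0, 1/e]`, and `a = √(ln(1/ζ))`.  If `X`
is a one-dimensional Gaussian with density `ρ_σ(x)/σ = exp(−πx²/σ²)/σ`, then the
statistical distance between `X mod p` (density `∑_{k∈ℤ} exp(−π(x+kp)²/σ²)/σ` on `[0,p)`)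
and the uniform distribution on `[0,p)` (density `1/p`) is at least `1 − ζ − 2aσ/p`. -/
theorem gaussian_mod_statDist_uniform_lb (σ p ζ : ℝ)
    (hσ : 0 < σ) (hp : 0 < p) (hζ : ζ ∈ Set.Ioc (0 : ℝ) (Real.exp (-1)))
    (a : ℝ) (ha : a = Real.sqrt (Real.log (1 / ζ))) :
    1 - ζ - 2 * a * σ / p ≤
      (1 / 2) * ∫ x in (0 : ℝ)..p,
        |(∑' k : ℤ, Real.exp (-Real.pi * (x + (k : ℝ) * p) ^ 2 / σ ^ 2)) / σ - 1 / p| := by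
  obtain ⟨hζ0, hζ1⟩ := hζ
  have hlog : 0 ≤ Real.log (1 / ζ) := by
    rw [one_div, Real.log_inv, neg_nonneg]
    exact Real.log_nonpos hζ0.le (hζ1.trans (Real.exp_le_one_iff.2 (by norm_num)))
  have ha0 : 0 ≤ a := ha ▸ Real.sqrt_nonneg _
  have hζa : Real.exp (-a ^ 2) = ζ := by
    rw [ha, Real.sq_sqrt hlog, one_div, Real.log_inv, neg_neg, Real.exp_log hζ0]
  have hscale : ∫ x in (0 : ℝ)..p,
      |(∑' k : ℤ, Real.exp (-Real.pi * (x + (k : ℝ) * p) ^ 2 / σ ^ 2)) / σ - 1 / p| =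
      ∫ y in (0 : ℝ)..1, |p / σ *
        (∑' k : ℤ, Real.exp (-(Real.pi * (p / σ) ^ 2) * (y + k) ^ 2)) - 1| := by
    have h := intervalIntegral.mul_integral_comp_mul_left (a := 0) (b := 1) (c := p) (f := fun x ↦
      |(∑' k : ℤ, Real.exp (-Real.pi * (x + (k : ℝ) * p) ^ 2 / σ ^ 2)) / σ - 1 / p|)
    rw [mul_zero, mul_one] at h
    rw [← h, ← intervalIntegral.integral_const_mul]
    refine intervalIntegral.integral_congr fun y _ ↦ ?_
    have hexp (k : ℤ) : Real.exp (-Real.pi * (p * y + (k : ℝ) * p) ^ 2 / σ ^ 2) =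
        Real.exp (-(Real.pi * (p / σ) ^ 2) * (y + k) ^ 2) := by
      congr 1
      ring
    simp only [hexp]
    nth_rw 1 [← abs_of_pos hp]
    rw [← abs_mul]
    congr 1
    field_simp
  rw [hscale]
  have hdiv : 2 * a * σ / p = 2 * (a * σ / p) := by ring
  rw [hdiv]
  rcases le_total (2 * (a * σ / p)) 1 with hb | hb
  · refine le_trans ?_ (one_sub_exp_sub_le_half_integral_abs_tsum_sub_one (div_pos hp hσ)
      (by positivity) hb)
    have hexp : -(Real.pi * (p / σ) ^ 2) * (a * σ / p) ^ 2 = -(Real.pi * a ^ 2) := by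
      field_simp
    have hle : Real.exp (-(Real.pi * a ^ 2)) ≤ ζ := by
      rw [← hζa]
      refine Real.exp_le_exp.2 ?_
      nlinarith [Real.pi_gt_three, sq_nonneg a]
    rw [hexp]
    linarith
  · have : 0 ≤ ∫ y in (0 : ℝ)..1, |p / σ *
        (∑' k : ℤ, Real.exp (-(Real.pi * (p / σ) ^ 2) * (y + k) ^ 2)) - 1| :=
      intervalIntegral.integral_nonneg zero_le_one fun _ _ ↦ abs_nonneg _
    linarith
end
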